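/- There exists an analytic subspace X of 2^ω × [0,1] such that F₀(X) is Σ¹₂-complete (as a subset of F(X) with an admissible topology). -/

import Mathlib

open Set Filter Topology TopologicalSpace

/-- `DimLE X n` : the topological (covering) dimension of `X` is at most `n`, i.e. every
finite open cover of `X` admits an open shrinking (refinement) of order at most `n + 1`. -/
def DimLE (X : Type*) [TopologicalSpace X] (n : ℕ) : Prop :=
  ∀ (k : ℕ) (U : Fin k → Set X), (∀ i, IsOpen (U i)) → (⋃ i, U i) = Set.univ →
    ∃ V : Fin k → Set X, (∀ i, IsOpen (V i)) ∧ (∀ i, V i ⊆ U i) ∧ (⋃ i, V i) = Set.univ ∧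
      ∀ x : X, ({i | x ∈ V i}).ncard ≤ n + 1

/-- The collection `F(X)` of closed subsets of `X`. -/
abbrev Cl (X : Type*) [TopologicalSpace X] : Type _ := {F : Set X // IsClosed F}

/-- `F₀(X)` : the set of all closed zero-dimensional subsets of `X`. -/
def F0 (X : Type*) [TopologicalSpace X] : Set (Cl X) := {F | DimLE (↥F.1) 0}

/-- The Vietoris topology on subsets of `Y`. -/
def vietoris (Y : Type*) [TopologicalSpace Y] : TopologicalSpace (Set Y) :=
  TopologicalSpace.generateFrom
    ({S | ∃ U : Set Y, IsOpen U ∧ S = {A : Set Y | A ⊆ U}} ∪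
     {S | ∃ U : Set Y, IsOpen U ∧ S = {A : Set Y | (A ∩ U).Nonempty}})

/-- A topology `τ` on `F(X)` is admissible if it is induced, via `F ↦ closure (e '' F)`,
by the Vietoris topology on some metrizable compactification `Y` of `X` (with embedding `e`). -/
def IsAdmissible (X : Type*) [tX : TopologicalSpace X] (τ : TopologicalSpace (Cl X)) : Prop :=
  ∃ (Y : Type) (tY : TopologicalSpace Y) (_ : @CompactSpace Y tY)
    (_ : @TopologicalSpace.MetrizableSpace Y tY) (e : X → Y),
      @Topology.IsEmbedding X Y tX tY e ∧
      τ = (@vietoris Y tY).induced (fun F : Cl X => @closure Y tY (e '' F.1))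

/-- An analytic space: a separable metrizable space which is empty or a continuous image
of the Baire space `ℕ → ℕ`. -/
def IsAnalyticSpace (X : Type*) [TopologicalSpace X] : Prop :=
  TopologicalSpace.MetrizableSpace X ∧ TopologicalSpace.SeparableSpace X ∧
    (IsEmpty X ∨ ∃ f : (ℕ → ℕ) → X, Continuous f ∧ Function.Surjective f)

/-- `Σ¹₂` subsets of a topological space: projections of co-analytic sets. -/
def IsSigma12 {W : Type*} [TopologicalSpace W] (s : Set W) : Prop :=
  ∃ B : Set (W × (ℕ → ℕ)), MeasureTheory.AnalyticSet Bᶜ ∧ s = {w | ∃ y, (w, y) ∈ B}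

/-- `Σ¹₂`-hardness (with Cantor space `2^ω = ℕ → Bool` as source). -/
def Sigma12Hard {W : Type*} [TopologicalSpace W] (A : Set W) : Prop :=
  ∀ A' : Set (ℕ → Bool), IsSigma12 A' →
    ∃ φ : (ℕ → Bool) → W, Continuous φ ∧ A' = φ ⁻¹' A

/-- `Π¹₁`-hardness. -/
def Pi11Hard {W : Type*} [TopologicalSpace W] (A : Set W) : Prop :=
  ∀ A' : Set (ℕ → Bool), MeasureTheory.AnalyticSet A'ᶜ →
    ∃ φ : (ℕ → Bool) → W, Continuous φ ∧ A' = φ ⁻¹' A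

/-- The additive Borel classes `Σ⁰ξ` : `Σ⁰₁` consists of the open sets, and for `ξ > 1`,
`Σ⁰ξ` consists of countable unions of sets whose complements are in some `Σ⁰η`, `η < ξ`. -/
inductive SigmaOrd {W : Type*} [TopologicalSpace W] : Ordinal.{0} → Set W → Prop
  | basic (s : Set W) : IsOpen s → SigmaOrd 1 s
  | union (ξ : Ordinal.{0}) (η : ℕ → Ordinal.{0}) (f : ℕ → Set W) (hξ : 1 < ξ)
      (hη : ∀ n, η n < ξ) (h : ∀ n, SigmaOrd (η n) (f n)ᶜ) : SigmaOrd ξ (⋃ n, f n)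

/-- The run produced when player I follows the strategy `σ` and player II plays `β`. -/
def playI (σ : List ℕ → ℕ) (β : ℕ → ℕ) : ℕ → ℕ := fun n =>
  if n % 2 = 0 then σ (List.ofFn fun i : Fin (n / 2) => β i) else β (n / 2)

/-- Player I has a winning strategy in the game `G_A`. -/
def PlayerIWins (A : Set (ℕ → ℕ)) : Prop :=
  ∃ σ : List ℕ → ℕ, ∀ β : ℕ → ℕ, playI σ β ∈ A

/-- The game operator `Game B` applied to `B ⊆ W × ω^ω`. -/
def GameOp {W : Type*} (B : Set (W × (ℕ → ℕ))) : Set W :=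
  {w | PlayerIWins {γ | (w, γ) ∈ B}}

/-- `Game Σ⁰ξ`-hardness. -/
def GameSigmaHard (ξ : Ordinal.{0}) {W : Type*} [TopologicalSpace W] (A : Set W) : Prop :=
  ∀ A' : Set (ℕ → Bool),
    (∃ B : Set ((ℕ → Bool) × (ℕ → ℕ)), SigmaOrd ξ B ∧ A' = GameOp B) →
    ∃ φ : (ℕ → Bool) → W, Continuous φ ∧ A' = φ ⁻¹' A

/-- A second countable space with a basis of clopen sets is zero-dimensional. -/
theorem dimLE_zero_of_clopen_basis {X : Type*} [TopologicalSpace X] [SecondCountableTopology X]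
    (h : ∀ (x : X) (U : Set X), IsOpen U → x ∈ U → ∃ H : Set X, IsClopen H ∧ x ∈ H ∧ H ⊆ U) :
    DimLE X 0 := by
  intro k U hU hcov
  have hx : ∀ x : X, ∃ (i : Fin k) (H : Set X), IsClopen H ∧ x ∈ H ∧ H ⊆ U i := by
    intro x
    obtain ⟨i, hi⟩ := mem_iUnion.1 (hcov.symm ▸ mem_univ x : x ∈ ⋃ i, U i)
    obtain ⟨H, hH⟩ := h x (U i) (hU i) hi
    exact ⟨i, H, hH⟩
  choose ι N hN hxN hNU using hx
  obtain ⟨T, hTc, hT⟩ := isOpen_iUnion_countable N fun x => (hN x).isOpen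
  have hTuniv : ⋃ x ∈ T, N x = univ := by
    rw [hT]
    exact eq_univ_of_forall fun x => mem_iUnion.2 ⟨x, hxN x⟩
  rcases T.eq_empty_or_nonempty with rfl | hne
  · have : IsEmpty X := by
      refine ⟨fun x => ?_⟩
      have := mem_univ x
      rw [← hTuniv] at this
      simp at this
    exact ⟨U, hU, fun _ => le_rfl, hcov, fun x => isEmptyElim x⟩
  obtain ⟨t, rfl⟩ := hTc.exists_eq_range hne
  rw [biUnion_range] at hTuniv
  have hD : ∀ j, IsOpen (disjointed (fun j => N (t j)) j) := by
    intro j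
    refine disjointedRec (f := fun j => N (t j)) (p := IsOpen) (fun {s i} hs => ?_) (hN _).isOpen
    exact hs.sdiff (hN _).isClosed
  refine ⟨fun i => ⋃ j ∈ {j | ι (t j) = i}, disjointed (fun j => N (t j)) j, fun i => ?_,
    fun i => ?_, ?_, fun x => ?_⟩
  · exact isOpen_biUnion fun j _ => hD j
  · refine iUnion₂_subset fun j hj => ?_
    rw [← show ι (t j) = i from hj]
    exact (disjointed_subset _ j).trans (hNU _)
  · refine eq_univ_of_forall fun x => ?_
    have hxm : x ∈ ⋃ j, disjointed (fun j => N (t j)) j := by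
      rw [iUnion_disjointed, hTuniv]; trivial
    obtain ⟨j, hj⟩ := mem_iUnion.1 hxm
    exact mem_iUnion.2 ⟨ι (t j), mem_iUnion₂.2 ⟨j, rfl, hj⟩⟩
  · rw [zero_add, Set.ncard_le_one_iff]
    intro a b ha hb
    obtain ⟨j, hj, hxj⟩ := mem_iUnion₂.1 ha
    obtain ⟨l, hl, hxl⟩ := mem_iUnion₂.1 hb
    have : j = l := by
      by_contra hjl
      exact Set.disjoint_left.1 (disjoint_disjointed (fun j => N (t j)) hjl) hxj hxl
    rw [← show ι (t j) = a from hj, ← show ι (t l) = b from hl, this]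

/-- In a zero-dimensional space, a closed set can be separated from the complement of an open
neighbourhood by a clopen set. -/
theorem DimLE.exists_separation {X : Type*} [TopologicalSpace X] (h : DimLE X 0) {C U : Set X}
    (hC : IsClosed C) (hU : IsOpen U) (hCU : C ⊆ U) :
    ∃ V : Bool → Set X, (∀ j, IsOpen (V j)) ∧ (∀ x, x ∈ V true ∨ x ∈ V false) ∧
      (∀ x, ¬ (x ∈ V true ∧ x ∈ V false)) ∧ V true ⊆ U ∧ Disjoint (V false) C := by
  obtain ⟨V, hVo, hVU, hVc, hV⟩ := h 2 ![U, Cᶜ] (by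
    intro i
    fin_cases i
    · exact hU
    · exact hC.isOpen_compl) (by
    refine eq_univ_of_forall fun x => mem_iUnion.2 ?_
    by_cases hx : x ∈ U
    · exact ⟨0, hx⟩
    · exact ⟨1, fun hx' => hx (hCU hx')⟩)
  refine ⟨fun j => V (bif j then 0 else 1), fun j => hVo _, fun x => ?_, fun x hx => ?_,
    hVU 0, ?_⟩
  · obtain ⟨i, hi⟩ := mem_iUnion.1 (hVc.symm ▸ mem_univ x : x ∈ ⋃ i, V i)
    fin_cases i
    · exact Or.inl hi
    · exact Or.inr hi
  · have h01 := (Set.ncard_le_one_iff (Set.toFinite _)).1 (hV x) hx.1 hx.2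
    simp at h01
  · exact Set.disjoint_left.2 fun x hx => hVU 1 hx

section Coding

variable {X : Type*} [TopologicalSpace X]

/-- The open set with code `y` at the entry `(m, n, j)`, with respect to the family `O`. -/
def codedOpen (O : ℕ → Set X) (y : ℕ → ℕ) (m n : ℕ) (j : Bool) : Set X :=
  {x | ∃ i, y (Encodable.encode (m, n, i, j)) = 0 ∧ x ∈ O i}

/-- The pairs of open sets coded by `y` behave at `x` like partitions separating `O m` from the
complement of `O n`, whenever `closure (O m) ⊆ O n`. -/
def SeparatesAt (O : ℕ → Set X) (y : ℕ → ℕ) (x : X) : Prop :=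
  ∀ m n, closure (O m) ⊆ O n →
    (x ∈ codedOpen O y m n true ∨ x ∈ codedOpen O y m n false) ∧
    ¬ (x ∈ codedOpen O y m n true ∧ x ∈ codedOpen O y m n false) ∧
    (x ∈ codedOpen O y m n true → x ∈ O n) ∧ (x ∈ codedOpen O y m n false → x ∉ O m)

theorem dimLE_zero_iff_exists_separatesAt [RegularSpace X] {O : ℕ → Set X}
    (hO : IsTopologicalBasis (range O)) (F : Set X) :
    DimLE F 0 ↔ ∃ y, ∀ x ∈ F, SeparatesAt O y x := by
  have hOo : ∀ i, IsOpen (O i) := fun i => hO.isOpen (mem_range_self i)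
  have : SecondCountableTopology X := hO.secondCountableTopology (countable_range O)
  constructor
  · intro h
    have key : ∀ m n, ∃ W : Bool → Set X, (∀ j, IsOpen (W j)) ∧ (closure (O m) ⊆ O n →
        ∀ x ∈ F, (x ∈ W true ∨ x ∈ W false) ∧ ¬ (x ∈ W true ∧ x ∈ W false) ∧
          (x ∈ W true → x ∈ O n) ∧ (x ∈ W false → x ∉ O m)) := by
      intro m n
      by_cases hmn : closure (O m) ⊆ O n
      · obtain ⟨V, hVo, h1, h2, h3, h4⟩ := h.exists_separation
          (C := Subtype.val ⁻¹' closure (O m)) (U := Subtype.val ⁻¹' O n)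
          (isClosed_closure.preimage continuous_subtype_val)
          ((hOo n).preimage continuous_subtype_val) (preimage_mono hmn)
        choose W hWo hW using fun j => isOpen_induced_iff.1 (hVo j)
        have hW' : ∀ j (x : F), x.1 ∈ W j ↔ x ∈ V j := fun j x => by rw [← hW j]; rfl
        refine ⟨W, hWo, fun _ x hx => ?_⟩
        simp only [hW' _ ⟨x, hx⟩]
        exact ⟨h1 _, h2 _, fun hxV => h3 hxV,
          fun hxV hxO => Set.disjoint_left.1 h4 hxV (subset_closure hxO)⟩
      · exact ⟨fun _ => ∅, fun _ => isOpen_empty, fun h => absurd h hmn⟩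
    choose W hWo hW using key
    classical
    obtain ⟨y, hy⟩ : ∃ y : ℕ → ℕ, ∀ m n i j,
        y (Encodable.encode (m, n, i, j)) = 0 ↔ O i ⊆ W m n j := by
      refine ⟨fun c => match (Encodable.decode c : Option (ℕ × ℕ × ℕ × Bool)) with
        | none => 1
        | some p => if O p.2.2.1 ⊆ W p.1 p.2.1 p.2.2.2 then 0 else 1, fun m n i j => ?_⟩
      simp
    refine ⟨y, fun x hx m n hmn => ?_⟩
    have hcod : ∀ j, x ∈ codedOpen O y m n j ↔ x ∈ W m n j := by
      intro j
      constructor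
      · rintro ⟨i, hi, hxi⟩
        exact (hy m n i j).1 hi hxi
      · intro hxW
        obtain ⟨_, ⟨i, rfl⟩, hxi, hs⟩ := hO.exists_subset_of_mem_open hxW (hWo m n j)
        exact ⟨i, (hy m n i j).2 hs, hxi⟩
    rw [hcod, hcod]
    exact hW m n hmn x hx
  · rintro ⟨y, hy⟩
    have hcO : ∀ m n j, IsOpen (codedOpen O y m n j) := by
      intro m n j
      have : codedOpen O y m n j =
          ⋃ i ∈ {i | y (Encodable.encode (m, n, i, j)) = 0}, O i := by
        ext x; simp [codedOpen]
      rw [this]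
      exact isOpen_biUnion fun i _ => hOo i
    apply dimLE_zero_of_clopen_basis
    intro x U hU hxU
    obtain ⟨W, hWo, rfl⟩ := isOpen_induced_iff.1 hU
    obtain ⟨_, ⟨n, rfl⟩, hxn, hnW⟩ := hO.exists_subset_of_mem_open hxU hWo
    obtain ⟨C, hC, hCc, hCn⟩ := exists_mem_nhds_isClosed_subset ((hOo n).mem_nhds hxn)
    obtain ⟨_, ⟨m, rfl⟩, hxm, hmC⟩ := hO.mem_nhds_iff.1 hC
    have hmn : closure (O m) ⊆ O n := (closure_minimal hmC hCc).trans hCn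
    refine ⟨Subtype.val ⁻¹' codedOpen O y m n true, ⟨?_, (hcO _ _ _).preimage
      continuous_subtype_val⟩, ?_, fun z hz => hnW ((hy z z.2 m n hmn).2.2.1 hz)⟩
    · have : (Subtype.val ⁻¹' codedOpen O y m n true : Set F) =
          (Subtype.val ⁻¹' codedOpen O y m n false)ᶜ := by
        ext z
        have := hy z z.2 m n hmn
        simp only [mem_preimage, mem_compl_iff]
        tauto
      rw [this]
      exact ((hcO _ _ _).preimage continuous_subtype_val).isClosed_compl
    · have := hy x x.2 m n hmn
      simp only [mem_preimage]
      tauto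

end Coding

section UpperBound

variable {X Y : Type*} [TopologicalSpace X] [TopologicalSpace Y] [CompactSpace Y]

theorem isOpen_vietoris_subset {Y : Type*} [TopologicalSpace Y] {U : Set Y} (hU : IsOpen U) :
    IsOpen[_root_.vietoris Y] {A : Set Y | A ⊆ U} :=
  isOpen_generateFrom_of_mem (Or.inl ⟨U, hU, rfl⟩)

theorem isOpen_vietoris_inter {Y : Type*} [TopologicalSpace Y] {U : Set Y} (hU : IsOpen U) :
    IsOpen[_root_.vietoris Y] {A : Set Y | (A ∩ U).Nonempty} :=
  isOpen_generateFrom_of_mem (Or.inr ⟨U, hU, rfl⟩)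

/-- The topology on `F(X)` induced by a map from `X` to a compact metrizable space is second
countable. -/
theorem secondCountableTopology_induced_vietoris [SecondCountableTopology Y] (e : X → Y) :
    @SecondCountableTopology (Cl X)
      ((_root_.vietoris Y).induced fun F : Cl X => closure (e '' F.1)) := by
  obtain ⟨b, hbc, -, hb⟩ := exists_countable_basis Y
  set c : Cl X → Set Y := fun F => closure (e '' F.1) with hc
  set 𝒱 : Set (Set Y) := (fun T : Set (Set Y) => ⋃₀ T) '' {T | T.Finite ∧ T ⊆ b} with h𝒱
  have h𝒱c : 𝒱.Countable := (Set.countable_ofPred_finite_subset hbc).image _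
  have h𝒱o : ∀ V ∈ 𝒱, IsOpen V := by
    rintro _ ⟨T, ⟨-, hT⟩, rfl⟩
    exact isOpen_sUnion fun t ht => hb.isOpen (hT ht)
  set 𝒮 : Set (Set (Cl X)) :=
    (fun V => {F | c F ⊆ V}) '' 𝒱 ∪ (fun V => {F | (c F ∩ V).Nonempty}) '' b with h𝒮
  refine @SecondCountableTopology.mk _ (_) ⟨𝒮, (h𝒱c.image _).union (hbc.image _), ?_⟩
  apply le_antisymm
  · rw [le_generateFrom_iff_subset_isOpen]
    rintro _ (⟨V, hV, rfl⟩ | ⟨V, hV, rfl⟩)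
    · exact ⟨_, isOpen_vietoris_subset (h𝒱o V hV), rfl⟩
    · exact ⟨_, isOpen_vietoris_inter (hb.isOpen hV), rfl⟩
  · rw [_root_.vietoris, induced_generateFrom_eq, le_generateFrom_iff_subset_isOpen]
    rintro _ ⟨_, ⟨U, hU, rfl⟩ | ⟨U, hU, rfl⟩, rfl⟩
    · have : c ⁻¹' {A | A ⊆ U} = ⋃ V ∈ {V | V ∈ 𝒱 ∧ V ⊆ U}, {F | c F ⊆ V} := by
        ext F
        simp only [mem_preimage, mem_ofPred_eq, mem_iUnion, exists_prop]
        constructor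
        · intro hF
          have hK : IsCompact (c F) := isClosed_closure.isCompact
          obtain ⟨T, hTs, hTf, hT⟩ := hK.elim_finite_subcover_image
            (b := {V | V ∈ b ∧ V ⊆ U}) (c := id) (fun V hV => hb.isOpen hV.1) (fun x hx => by
              obtain ⟨V, hV, hxV, hVU⟩ := hb.exists_subset_of_mem_open (hF hx) hU
              exact mem_iUnion₂.2 ⟨V, ⟨hV, hVU⟩, hxV⟩)
          refine ⟨⋃₀ T, ⟨⟨T, ⟨hTf, fun V hV => (hTs hV).1⟩, rfl⟩,
            sUnion_subset fun V hV => (hTs hV).2⟩, ?_⟩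
          rwa [sUnion_eq_biUnion]
        · rintro ⟨V, ⟨-, hVU⟩, hF⟩
          exact hF.trans hVU
      rw [this, mem_ofPred_eq]
      refine @isOpen_biUnion _ _ (generateFrom 𝒮) _ _ fun V hV => ?_
      exact isOpen_generateFrom_of_mem (Or.inl ⟨V, hV.1, rfl⟩)
    · have : c ⁻¹' {A | (A ∩ U).Nonempty} =
          ⋃ V ∈ {V | V ∈ b ∧ V ⊆ U}, {F | (c F ∩ V).Nonempty} := by
        ext F
        simp only [mem_preimage, mem_ofPred_eq, mem_iUnion, exists_prop]
        constructor
        · rintro ⟨x, hx, hxU⟩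
          obtain ⟨V, hV, hxV, hVU⟩ := hb.exists_subset_of_mem_open hxU hU
          exact ⟨V, ⟨hV, hVU⟩, x, hx, hxV⟩
        · rintro ⟨V, ⟨-, hVU⟩, x, hx, hxV⟩
          exact ⟨x, hx, hVU hxV⟩
      rw [this, mem_ofPred_eq]
      refine @isOpen_biUnion _ _ (generateFrom 𝒮) _ _ fun V hV => ?_
      exact isOpen_generateFrom_of_mem (Or.inr ⟨V, hV.1, rfl⟩)

/-- If `X` is analytic, sending a sequence of points of `X`, given by preimages in the Baire space,
to its closure is a Borel map to `F(X)`. -/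
theorem measurable_closure_range [MetrizableSpace Y] {e : X → Y} (he : IsEmbedding e)
    {f : (ℕ → ℕ) → X} (hf : Continuous f) :
    @Measurable (ℕ → ℕ → ℕ) (Cl X) _
      (@borel _ ((_root_.vietoris Y).induced fun F : Cl X => closure (e '' F.1)))
      (fun u => ⟨closure (range fun i => f (u i)), isClosed_closure⟩) := by
  let _ := metrizableSpaceMetric Y
  have hcl : ∀ u : ℕ → ℕ → ℕ, closure (e '' closure (range fun i => f (u i))) =
      closure (range fun i => e (f (u i))) := by
    intro u
    rw [closure_image_closure he.continuous, ← range_comp]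
    rfl
  have hcont : ∀ i, Continuous fun u : ℕ → ℕ → ℕ => e (f (u i)) := fun i =>
    he.continuous.comp (hf.comp (continuous_apply i))
  have hsc := secondCountableTopology_induced_vietoris e
  rw [@borel_eq_generateFrom_of_subbasis _ _ (_) hsc (induced_generateFrom_eq)]
  refine measurable_generateFrom ?_
  rintro _ ⟨_, ⟨U, hU, rfl⟩ | ⟨U, hU, rfl⟩, rfl⟩
  · simp only [preimage_ofPred_eq, hcl]
    have : {u : ℕ → ℕ → ℕ | closure (range fun i => e (f (u i))) ⊆ U} =
        ⋃ n : ℕ, ⋂ i, (fun u : ℕ → ℕ → ℕ => e (f (u i))) ⁻¹'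
          (Metric.thickening (1 / (n + 1 : ℝ)) Uᶜ)ᶜ := by
      ext u
      simp only [mem_ofPred_eq, mem_iUnion, mem_iInter, mem_preimage]
      constructor
      · intro hu
        obtain ⟨δ, hδ, hd⟩ := Disjoint.exists_thickenings (disjoint_compl_right_iff_subset.2 hu)
          isClosed_closure.isCompact hU.isClosed_compl
        obtain ⟨n, hn⟩ := exists_nat_one_div_lt hδ
        refine ⟨n, fun i hi => Set.disjoint_left.1 hd ?_ (Metric.thickening_mono hn.le _ hi)⟩
        exact Metric.self_subset_thickening hδ _ (subset_closure (mem_range_self i))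
      · rintro ⟨n, hn⟩
        refine (closure_minimal (range_subset_iff.2 hn)
          Metric.isOpen_thickening.isClosed_compl).trans (compl_subset_comm.1 ?_)
        exact Metric.self_subset_thickening Nat.one_div_pos_of_nat _
    rw [this]
    exact MeasurableSet.iUnion fun n => (isClosed_iInter fun i =>
      Metric.isOpen_thickening.isClosed_compl.preimage (hcont i)).measurableSet
  · simp only [preimage_ofPred_eq, hcl]
    have : {u : ℕ → ℕ → ℕ | (closure (range fun i => e (f (u i))) ∩ U).Nonempty} =
        ⋃ i, (fun u : ℕ → ℕ → ℕ => e (f (u i))) ⁻¹' U := by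
      ext u
      rw [mem_ofPred_eq, closure_inter_open_nonempty_iff hU]
      simp [Set.Nonempty]
    rw [this]
    exact (isOpen_iUnion fun i => hU.preimage (hcont i)).measurableSet

theorem measurableSet_separatesAt {O : ℕ → Set X} (hO : ∀ i, IsOpen (O i))
    {f : (ℕ → ℕ) → X} (hf : Continuous f) :
    MeasurableSet {p : (ℕ → ℕ → ℕ) × (ℕ → ℕ) | SeparatesAt O p.2 (f (p.1 0))} := by
  have hO' : ∀ i, Measurable fun p : (ℕ → ℕ → ℕ) × (ℕ → ℕ) => f (p.1 0) ∈ O i := fun i =>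
    measurableSet_setOfPred.1 ((hO i).preimage
      (hf.comp ((continuous_apply 0).comp continuous_fst))).measurableSet
  have hc : ∀ m n j, Measurable fun p : (ℕ → ℕ → ℕ) × (ℕ → ℕ) =>
      f (p.1 0) ∈ codedOpen O p.2 m n j := by
    refine fun m n j => Measurable.exists fun i => Measurable.and ?_ (hO' i)
    exact measurableSet_setOfPred.1 (measurableSet_eq_fun
      ((measurable_pi_apply _).comp measurable_snd) measurable_const)
  refine measurableSet_setOfPred.2 <| Measurable.forall fun m => Measurable.forall fun n =>
    measurable_const.imp ?_
  exact ((hc m n true).or (hc m n false)).and <|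
    ((hc m n true).and (hc m n false)).not.and <|
    ((hc m n true).imp (hO' n)).and ((hc m n false).imp (hO' m).not)

/-- If `X` is analytic, then `F₀(X)` is `Σ¹₂` for every admissible topology. -/
theorem isSigma12_F0 {f : (ℕ → ℕ) → X} (hf : Continuous f) (hfs : Function.Surjective f)
    {τ : TopologicalSpace (Cl X)} (hτ : IsAdmissible X τ) : @IsSigma12 _ τ (F0 X) := by
  obtain ⟨Y, tY, hY, hYm, e, he, rfl⟩ := hτ
  let _ : TopologicalSpace (Cl X) :=
    (_root_.vietoris Y).induced fun F : Cl X => closure (e '' F.1)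
  have hYs : SecondCountableTopology Y := by
    let _ := metrizableSpaceMetric Y
    infer_instance
  have hsc : SecondCountableTopology (Cl X) := secondCountableTopology_induced_vietoris e
  have hXs : SecondCountableTopology X := he.secondCountableTopology
  have hXm : MetrizableSpace X := he.metrizableSpace
  let _ : MeasurableSpace (Cl X) := borel _
  have : BorelSpace (Cl X) := ⟨rfl⟩
  have hXne : Nonempty X := ⟨f 0⟩
  obtain ⟨b, hbc, hbne, hb⟩ := exists_countable_basis X
  have hbne' : b.Nonempty := by
    rw [nonempty_iff_ne_empty]
    rintro rfl
    have := hb.sUnion_eq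
    rw [sUnion_empty] at this
    exact univ_nonempty.ne_empty this.symm
  obtain ⟨O, rfl⟩ := hbc.exists_eq_range hbne'
  have hOo : ∀ i, IsOpen (O i) := fun i => hb.isOpen (mem_range_self i)
  refine ⟨{p | ∀ x ∈ p.1.1, SeparatesAt O p.2 x}, ?_, ?_⟩
  · have hΦ : Measurable (fun p : (ℕ → ℕ → ℕ) × (ℕ → ℕ) =>
        ((⟨closure (range fun i => f (p.1 i)), isClosed_closure⟩, p.2) : Cl X × (ℕ → ℕ))) :=
      ((measurable_closure_range he hf).comp measurable_fst).prodMk measurable_snd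
    convert (measurableSet_separatesAt hOo hf).compl.analyticSet_image hΦ using 1
    ext ⟨F, y⟩
    constructor
    · intro h
      simp only [mem_compl_iff, mem_ofPred_eq, not_forall] at h
      obtain ⟨x, hxF, hx⟩ := h
      have : Nonempty F.1 := ⟨⟨x, hxF⟩⟩
      obtain ⟨d, hd⟩ := exists_dense_seq F.1
      choose g hg using hfs
      refine ⟨(fun i => Nat.casesOn i (g x) fun i => g (d i), y), ?_, ?_⟩
      · simpa [hg] using hx
      · refine Prod.ext (Subtype.ext ?_) rfl
        refine subset_antisymm (closure_minimal ?_ F.2) fun z hz => ?_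
        · rintro _ ⟨i, rfl⟩
          cases i with
          | zero => simpa [hg] using hxF
          | succ i => simp [hg]
        · have := (closure_subtype (x := (⟨z, hz⟩ : F.1))).1 (hd ⟨z, hz⟩)
          refine closure_mono ?_ this
          rintro _ ⟨_, ⟨i, rfl⟩, rfl⟩
          exact ⟨i + 1, hg _⟩
    · rintro ⟨⟨u, y⟩, hu, h⟩
      obtain ⟨rfl, rfl⟩ := Prod.mk.inj h
      exact fun h => hu (h _ (subset_closure (mem_range_self 0)))
  · ext F
    exact dimLE_zero_iff_exists_separatesAt hb F.1

end UpperBound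

section Construction

/-- Every analytic set is the projection of a closed set. -/
theorem MeasureTheory.AnalyticSet.exists_isClosed_proj {α : Type*} [TopologicalSpace α] [T2Space α]
    {s : Set α} (hs : MeasureTheory.AnalyticSet s) :
    ∃ D : Set (α × (ℕ → ℕ)), IsClosed D ∧ ∀ a, a ∈ s ↔ ∃ z, (a, z) ∈ D := by
  rw [MeasureTheory.AnalyticSet] at hs
  rcases hs with rfl | ⟨f, hf, rfl⟩
  · exact ⟨∅, isClosed_empty, by simp⟩
  · exact ⟨{p | f p.2 = p.1}, isClosed_eq (hf.comp continuous_snd) continuous_fst, by simp⟩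

/-- There is a closed-set coding such that the sections of every closed subset of `2^ω × α` are
coded continuously. -/
theorem exists_universal_closed (α : Type*) [TopologicalSpace α] [SecondCountableTopology α] :
    ∃ O : ℕ → Set α, (∀ n, IsOpen (O n)) ∧ ∀ D : Set ((ℕ → Bool) × α), IsClosed D →
      ∃ w : (ℕ → Bool) → (ℕ → Bool), Continuous w ∧
        ∀ x a, (x, a) ∈ D ↔ ∀ n, w x n = true → a ∉ O n := by
  classical
  have hcl : Countable (Clopens (ℕ → Bool)) :=
    Clopens.countable_iff_secondCountable.2 inferInstance
  obtain ⟨b, hbc, -, hb⟩ := exists_countable_basis α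
  have : Countable b := hbc
  obtain ⟨t, ht⟩ : ∃ t : ℕ → Option (Clopens (ℕ → Bool) × b), Function.Surjective t :=
    exists_surjective_nat _
  let A : ℕ → Set (ℕ → Bool) := fun n => (t n).elim ∅ fun p => p.1
  let O : ℕ → Set α := fun n => (t n).elim ∅ fun p => p.2
  have hA : ∀ n, IsClopen (A n) := by
    intro n
    simp only [A]
    cases t n with
    | none => exact isClopen_empty
    | some p => exact p.1.isClopen
  have hO : ∀ n, IsOpen (O n) := by
    intro n
    simp only [O]
    cases t n with
    | none => exact isOpen_empty
    | some p => exact hb.isOpen p.2.2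
  refine ⟨O, hO, fun D hD => ⟨fun x n => decide (x ∈ A n ∧ A n ×ˢ O n ⊆ Dᶜ), ?_, ?_⟩⟩
  · refine continuous_pi fun n => ?_
    by_cases h : A n ×ˢ O n ⊆ Dᶜ
    · simp only [h, and_true]
      rw [continuous_bool_rng true]
      convert hA n using 1
      ext x
      simp
    · simp only [h, and_false]
      exact continuous_const
  · intro x a
    simp only [decide_eq_true_eq]
    constructor
    · rintro hxa n ⟨hx, hn⟩ ha
      exact hn ⟨hx, ha⟩ hxa
    · intro h
      by_contra hxa
      obtain ⟨U, V, hU, hV, hxU, haV, hUV⟩ := isOpen_prod_iff.1 hD.isOpen_compl x a hxa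
      obtain ⟨H, hH, hxH, hHU⟩ := compact_exists_isClopen_in_isOpen hU hxU
      obtain ⟨W, hW, haW, hWV⟩ := hb.exists_subset_of_mem_open haV hV
      obtain ⟨n, hn⟩ := ht (some (⟨H, hH⟩, ⟨W, hW⟩))
      have hAn : A n = H := by simp [A, hn]
      have hOn : O n = W := by simp [O, hn]
      refine h n ⟨hAn ▸ hxH, ?_⟩ (hOn ▸ haW)
      rw [hAn, hOn]
      exact (prod_mono hHU hWV).trans hUV

theorem not_countable_of_isOpen_unitInterval {U : Set (Icc (0 : ℝ) 1)} (hU : IsOpen U)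
    (hne : U.Nonempty) : ¬ U.Countable := by
  obtain ⟨V, hV, rfl⟩ := isOpen_induced_iff.1 hU
  obtain ⟨⟨s, hs⟩, hsV⟩ := hne
  intro hc
  have hcl : s ∈ closure (Ioo (0 : ℝ) 1) := by rwa [closure_Ioo zero_ne_one]
  have hne' : (V ∩ Ioo (0 : ℝ) 1).Nonempty := mem_closure_iff.1 hcl V hV hsV
  have hc' : (V ∩ Ioo (0 : ℝ) 1).Countable := by
    refine (hc.image Subtype.val).mono ?_
    rintro r ⟨hrV, hr⟩
    exact ⟨⟨r, Ioo_subset_Icc_self hr⟩, hrV, rfl⟩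
  have h1 := cardinal_eq_of_isOpen ℝ (hV.inter isOpen_Ioo) hne'
  have h2 := Cardinal.le_aleph0_iff_set_countable.2 hc'
  rw [h1, Cardinal.mk_real] at h2
  exact absurd h2 (not_le.2 Cardinal.aleph0_lt_continuum)

theorem exists_measurable_surjOn {S : Set (Icc (0 : ℝ) 1)} (hS : MeasurableSet S)
    (hc : ¬ S.Countable) : ∃ g : Icc (0 : ℝ) 1 → (ℕ → ℕ), Measurable g ∧ SurjOn g S univ := by
  have := hS.standardBorel
  have hB : ¬ Countable (ℕ → ℕ) := by
    rw [← Cardinal.mk_le_aleph0_iff]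
    simp [Cardinal.aleph0_lt_continuum]
  let E : S ≃ᵐ (ℕ → ℕ) := PolishSpace.measurableEquivOfNotCountable hc hB
  obtain ⟨g, hg, hgE⟩ := (MeasurableEmbedding.subtype_coe hS).exists_measurable_extend E.measurable
    fun _ => inferInstance
  refine ⟨g, hg, fun y _ => ⟨E.symm y, (E.symm y).2, ?_⟩⟩
  simpa using congr_fun hgE (E.symm y)

/-- There is an analytic subset `C` of `2^ω × [0,1]` with dense sections such that every `Σ¹₂` set
reduces continuously to the set of all `w` for which the complement of the section `C_w` is dense,
in such a way that the remaining sections are full. -/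
theorem exists_universal_analytic : ∃ C : Set ((ℕ → Bool) × Icc (0 : ℝ) 1),
    MeasureTheory.AnalyticSet C ∧ (∀ w, Dense {s | (w, s) ∈ C}) ∧
    ∀ A : Set (ℕ → Bool), IsSigma12 A → ∃ w : (ℕ → Bool) → (ℕ → Bool), Continuous w ∧
      (∀ x ∈ A, Dense {s | (w x, s) ∉ C}) ∧ (∀ x ∉ A, ∀ s, (w x, s) ∈ C) := by
  have : PolishSpace (Icc (0 : ℝ) 1) := isClosed_Icc.polishSpace
  have : PolishSpace (ℕ → Bool) := {}
  obtain ⟨R, hRc, hRd⟩ := exists_countable_dense (Icc (0 : ℝ) 1)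
  obtain ⟨b, hbc, hbe, hb⟩ := exists_countable_basis (Icc (0 : ℝ) 1)
  have : Countable b := hbc
  have hg : ∀ U : b, ∃ g : Icc (0 : ℝ) 1 → (ℕ → ℕ), Measurable g ∧ SurjOn g (U \ R) univ := by
    intro U
    have hU := hb.isOpen U.2
    refine exists_measurable_surjOn (hU.measurableSet.diff hRc.measurableSet) fun h => ?_
    refine not_countable_of_isOpen_unitInterval hU
      (nonempty_iff_ne_empty.2 fun h => hbe (h ▸ U.2)) ?_
    exact (h.union hRc).mono (by rw [sdiff_union_self]; exact subset_union_left)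
  choose g hgm hgs using hg
  have hbn : Nonempty b := by
    obtain ⟨U, hU, -⟩ := hb.exists_subset_of_mem_open (mem_univ (0 : Icc (0 : ℝ) 1)) isOpen_univ
    exact ⟨⟨U, hU⟩⟩
  obtain ⟨O, hO, hOu⟩ := exists_universal_closed ((ℕ → ℕ) × (ℕ → ℕ))
  refine ⟨⋂ U : b, {p | p.2 ∈ (U : Set _) \ R → ∃ z, ∀ n, p.1 n = true → (g U p.2, z) ∉ O n},
    MeasureTheory.AnalyticSet.iInter fun U => ?_,
    fun w => hRd.mono fun s hs => mem_iInter.2 fun U h => absurd hs h.2, fun A hA => ?_⟩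
  · have hm : MeasurableSet {p : ((ℕ → Bool) × Icc (0 : ℝ) 1) × (ℕ → ℕ) |
        p.1.2 ∈ (U : Set (Icc (0 : ℝ) 1)) \ R →
          ∀ n, p.1.1 n = true → (g U p.1.2, p.2) ∉ O n} := by
      refine measurableSet_setOfPred.2 <| Measurable.imp ?_ <| Measurable.forall fun n =>
        Measurable.imp ?_ <| Measurable.not ?_
      · exact measurableSet_setOfPred.1 <| (((hb.isOpen U.2).measurableSet.diff
          hRc.measurableSet).preimage (measurable_snd.comp measurable_fst))
      · exact measurableSet_setOfPred.1 <| measurableSet_eq_fun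
          ((measurable_pi_apply n).comp (measurable_fst.comp measurable_fst)) measurable_const
      · exact measurableSet_setOfPred.1 <| (hO n).measurableSet.preimage
          (((hgm U).comp (measurable_snd.comp measurable_fst)).prodMk measurable_snd)
    convert hm.analyticSet.image_of_continuous continuous_fst using 1
    ext p
    simp only [mem_ofPred_eq, mem_image, Prod.exists, exists_and_right, exists_eq_right]
    by_cases h : p.2 ∈ (U : Set (Icc (0 : ℝ) 1)) \ R
    · simp [h]
    · simp [h]
  · obtain ⟨B, hB, rfl⟩ := hA
    obtain ⟨D, hD, hBD⟩ := hB.exists_isClosed_proj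
    obtain ⟨w, hw, hwD⟩ := hOu ((Homeomorph.prodAssoc _ _ _).symm ⁻¹' D)
      (hD.preimage (Homeomorph.continuous _))
    have hBw : ∀ x y, (x, y) ∈ B ↔ ¬ ∃ z, ∀ n, w x n = true → (y, z) ∉ O n := by
      intro x y
      rw [← not_iff_not, not_not, ← mem_compl_iff, hBD]
      exact exists_congr fun z => hwD x (y, z)
    refine ⟨w, hw, ?_, ?_⟩
    · rintro x ⟨y, hy⟩
      refine hb.dense_iff.2 fun U hU _ => ?_
      obtain ⟨s, hs, hsy⟩ := hgs ⟨U, hU⟩ (mem_univ y)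
      refine ⟨s, hs.1, fun hsC => (hBw x y).1 hy ?_⟩
      rw [← hsy]
      exact mem_iInter.1 hsC ⟨U, hU⟩ hs
    · intro x hx s
      refine mem_iInter.2 fun U _ => ?_
      by_contra h
      exact hx ⟨g U s, (hBw x _).2 h⟩

/-- A space embedded into `[0,1]` with dense complement is zero-dimensional. -/
theorem dimLE_zero_of_dense_compl_range {F : Type*} [TopologicalSpace F] {ι : F → Icc (0 : ℝ) 1}
    (hι : IsEmbedding ι) (hd : Dense (range ι)ᶜ) : DimLE F 0 := by
  have : SecondCountableTopology F := hι.secondCountableTopology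
  refine dimLE_zero_of_clopen_basis fun x U hU hxU => ?_
  obtain ⟨V, hV, rfl⟩ := hι.isInducing.isOpen_iff.1 hU
  obtain ⟨ε, hε, hεV⟩ := Metric.isOpen_iff.1 hV (ι x) hxU
  have hval : Continuous fun z => (ι z : ℝ) := continuous_subtype_val.comp hι.continuous
  have hgap : ∀ a b : ℝ, a < b → 0 ≤ a → b ≤ 1 → ∃ c, a < c ∧ c < b ∧ ∀ z, (ι z : ℝ) ≠ c := by
    intro a b hab ha hb
    obtain ⟨c, hc, hcr⟩ := hd.inter_open_nonempty (Subtype.val ⁻¹' Ioo a b)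
      (isOpen_Ioo.preimage continuous_subtype_val)
      ⟨⟨(a + b) / 2, by constructor <;> linarith⟩, by constructor <;> simp <;> linarith⟩
    exact ⟨c, hc.1, hc.2, fun z hz => hcr ⟨z, Subtype.ext hz⟩⟩
  have hlow : ∃ H : Set F, IsClopen H ∧ x ∈ H ∧ ∀ z ∈ H, (ι x : ℝ) - ε < ι z := by
    by_cases h : (ι x : ℝ) - ε < 0
    · exact ⟨univ, isClopen_univ, trivial, fun z _ => h.trans_le (ι z).2.1⟩
    · obtain ⟨c, hc, hcx, hcz⟩ := hgap (ι x - ε) (ι x) (by linarith) (not_lt.1 h) (ι x).2.2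
      refine ⟨{z | c < ι z}, ⟨?_, isOpen_lt continuous_const hval⟩, hcx, fun z hz => hc.trans hz⟩
      have : {z | c < ι z} = {z | c ≤ ι z} := by
        ext z
        exact ⟨fun h : c < ι z => h.le, fun h => lt_of_le_of_ne h (hcz z).symm⟩
      rw [this]
      exact isClosed_le continuous_const hval
  have hupp : ∃ H : Set F, IsClopen H ∧ x ∈ H ∧ ∀ z ∈ H, (ι z : ℝ) < ι x + ε := by
    by_cases h : 1 < (ι x : ℝ) + ε
    · exact ⟨univ, isClopen_univ, trivial, fun z _ => (ι z).2.2.trans_lt h⟩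
    · obtain ⟨c, hcx, hc, hcz⟩ := hgap (ι x) (ι x + ε) (by linarith) (ι x).2.1 (not_lt.1 h)
      refine ⟨{z | ι z < c}, ⟨?_, isOpen_lt hval continuous_const⟩, hcx,
        fun z hz => lt_trans hz hc⟩
      have : {z | ι z < c} = {z | ι z ≤ c} := by
        ext z
        exact ⟨fun h : ι z < c => h.le, fun h => lt_of_le_of_ne h (hcz z)⟩
      rw [this]
      exact isClosed_le hval continuous_const
  obtain ⟨H, hH, hxH, hHl⟩ := hlow
  obtain ⟨K, hK, hxK, hKu⟩ := hupp
  refine ⟨H ∩ K, hH.inter hK, ⟨hxH, hxK⟩, fun z hz => hεV ?_⟩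
  rw [Metric.mem_ball, Subtype.dist_eq, Real.dist_eq, abs_lt]
  constructor <;> linarith [hHl z hz.1, hKu z hz.2]

/-- A space homeomorphic to `[0,1]` is not zero-dimensional. -/
theorem not_dimLE_zero_of_surjective {F : Type*} [TopologicalSpace F] {ι : F → Icc (0 : ℝ) 1}
    (hι : IsEmbedding ι) (hs : Function.Surjective ι) : ¬ DimLE F 0 := by
  intro h
  have : PreconnectedSpace F :=
    (hι.toHomeomorphOfSurjective hs).symm.surjective.denseRange.preconnectedSpace
      (hι.toHomeomorphOfSurjective hs).symm.continuous
  obtain ⟨V, hV, h1, h2, h3, h4⟩ := h.exists_separation (C := ι ⁻¹' {0}) (U := ι ⁻¹' {1}ᶜ)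
    (isClosed_singleton.preimage hι.continuous)
    (isClosed_singleton.isOpen_compl.preimage hι.continuous) (by
      intro z hz
      simp only [mem_preimage, mem_singleton_iff, mem_compl_iff] at hz ⊢
      simp [hz])
  have hcl : IsClopen (V true) := by
    refine ⟨?_, hV _⟩
    have : V true = (V false)ᶜ := by
      ext z
      have := h1 z
      have := h2 z
      simp only [mem_compl_iff]
      tauto
    rw [this]
    exact (hV _).isClosed_compl
  obtain ⟨z₀, hz₀⟩ := hs 0
  obtain ⟨z₁, hz₁⟩ := hs 1
  rcases isClopen_iff.1 hcl with he | he
  · rcases h1 z₀ with h0 | h0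
    · simp [he] at h0
    · exact Set.disjoint_left.1 h4 h0 hz₀
  · exact h3 (he ▸ mem_univ z₁ : z₁ ∈ V true) hz₁

/-- A continuous map into a compact metric space, defined on a subset of `K × P` with full sections
over a dense set `Q` whose complement is a dense `Gδ`, extends continuously over a whole section
`K × {p}` for some `p` outside of `Q`. -/
theorem exists_section_extension {K P Y : Type*} [TopologicalSpace K] [CompactSpace K]
    [TopologicalSpace P] [BaireSpace P] [Nonempty P] [MetricSpace Y] [CompactSpace Y]
    {Q : Set P} (hQ : Dense Q) (hQG : IsGδ Qᶜ) (hQc : Dense Qᶜ) {M : Set (K × P)}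
    (hM : ∀ k, ∀ q ∈ Q, (k, q) ∈ M) {e : M → Y} (he : Continuous e) :
    ∃ p ∉ Q, ∃ E : C(K, Y), ∀ k (h : (k, p) ∈ M), E k = e ⟨(k, p), h⟩ := by
  let f : Q → C(K, Y) := fun q =>
    ⟨fun k => e ⟨(k, q), hM k q q.2⟩, he.comp (by fun_prop)⟩
  let Near : Q → ℝ → P → Prop := fun q ε b => ∀ k (h : (k, b) ∈ M), dist (e ⟨(k, b), h⟩) (f q k) < ε
  have hclose : ∀ (q : Q) (ε : ℝ), 0 < ε → ∀ᶠ b in 𝓝 (q : P), Near q ε b := by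
    intro q ε hε
    have := isCompact_univ.eventually_forall_of_forall_eventually (X := P) (Y := K) (x₀ := q)
      (P := fun b k => ∀ h : (k, b) ∈ M, dist (e ⟨(k, b), h⟩) (f q k) < ε) (by
        intro k _
        have h1 : ∀ᶠ m : M in 𝓝 ⟨(k, q), hM k q q.2⟩, dist (e m) (f q m.1.1) < ε := by
          have hc : Continuous fun m : M => dist (e m) (f q m.1.1) := by fun_prop
          refine hc.continuousAt.eventually_lt continuousAt_const ?_
          simpa [f] using hε
        rw [nhds_subtype_eq_comap, eventually_comap] at h1
        have hsw : Tendsto (fun z : P × K => (z.2, z.1)) (𝓝 (q, k)) (𝓝 (k, q)) :=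
          (continuous_snd.prodMk continuous_fst).tendsto _
        filter_upwards [hsw.eventually h1] with z hz h
        exact hz ⟨_, h⟩ rfl)
    simpa [Near] using this
  let G : ℕ → Set P := fun n => ⋃ q : Q, interior {b | Near q (1 / (n + 1)) b}
  have hG : Dense (⋂ n, G n) := by
    refine dense_iInter_of_isOpen (fun n => isOpen_iUnion fun q => isOpen_interior) fun n => ?_
    refine hQ.mono fun q hq => mem_iUnion.2 ⟨⟨q, hq⟩, ?_⟩
    rw [mem_interior_iff_mem_nhds]
    exact hclose ⟨q, hq⟩ _ Nat.one_div_pos_of_nat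
  have hGδ : IsGδ (⋂ n, G n) :=
    IsGδ.iInter_of_isOpen fun n => isOpen_iUnion fun q => isOpen_interior
  obtain ⟨p, hpG, hpQ⟩ := (hG.inter_of_Gδ hGδ hQG hQc).nonempty
  have hp : ∀ n : ℕ, ∃ q : Q, p ∈ interior {b | Near q (1 / (n + 1)) b} := fun n =>
    mem_iUnion.1 (mem_iInter.1 hpG n)
  choose q hq using hp
  have hcau : CauchySeq fun n => f (q n) := by
    have hb : ∀ n m, dist (f (q n)) (f (q m)) ≤ 1 / ((n : ℝ) + 1) + 1 / ((m : ℝ) + 1) := by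
      intro n m
      obtain ⟨r, ⟨hrn, hrm⟩, hrQ⟩ := hQ.inter_open_nonempty _
        (isOpen_interior.inter isOpen_interior) ⟨p, hq n, hq m⟩
      refine (ContinuousMap.dist_le (by positivity)).2 fun k => ?_
      have h1 := interior_subset hrn k (hM k r hrQ)
      have h2 := interior_subset hrm k (hM k r hrQ)
      exact (dist_triangle_left _ _ _).trans (add_le_add h1.le h2.le)
    refine Metric.cauchySeq_iff.2 fun ε hε => ?_
    obtain ⟨N, hN⟩ := exists_nat_one_div_lt (half_pos hε)
    refine ⟨N, fun m hm n hn => (hb m n).trans_lt ?_⟩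
    have h1 := Nat.one_div_le_one_div (α := ℝ) hm
    have h2 := Nat.one_div_le_one_div (α := ℝ) hn
    linarith
  obtain ⟨E, hE⟩ := cauchySeq_tendsto_of_complete hcau
  refine ⟨p, hpQ, E, fun k h => ?_⟩
  have h1 : Tendsto (fun n => f (q n) k) atTop (𝓝 (E k)) :=
    ((continuous_eval_const k).tendsto E).comp hE
  refine tendsto_nhds_unique h1 ?_
  rw [tendsto_iff_dist_tendsto_zero]
  refine squeeze_zero (fun _ => dist_nonneg) (fun n => ?_) tendsto_one_div_add_atTop_nhds_zero_nat
  rw [dist_comm]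
  exact (interior_subset (hq n) k h).le

theorem dense_setOf_eventually_eq (c : Bool) :
    Dense {b : ℕ → Bool | ∃ N, ∀ n ≥ N, b n = c} := by
  intro b
  refine mem_closure_of_tendsto (f := fun k : ℕ => fun n => if n < k then b n else c)
    (b := atTop) ?_ ?_
  · refine tendsto_pi_nhds.2 fun n => tendsto_const_nhds.congr' ?_
    filter_upwards [eventually_gt_atTop n] with k hk
    simp [hk]
  · exact Eventually.of_forall fun k => ⟨k, fun n hn => by simp [not_lt.2 hn]⟩

theorem isOpen_setOf_exists_ge_eq (N : ℕ) (c : Bool) :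
    IsOpen {b : ℕ → Bool | ∃ n ≥ N, b n = c} := by
  have : {b : ℕ → Bool | ∃ n ≥ N, b n = c} = ⋃ n ≥ N, (fun b => b n) ⁻¹' {c} := by
    ext b; simp
  rw [this]
  exact isOpen_biUnion fun n _ => (isOpen_discrete {c}).preimage (continuous_apply n)

/-- The topology of `2^ω` admits a dense set whose complement is a dense `Gδ`. -/
theorem exists_dense_compl_dense_isGδ : ∃ Q : Set (ℕ → Bool), Dense Q ∧ IsGδ Qᶜ ∧ Dense Qᶜ := by
  have h : {b : ℕ → Bool | ∃ N, ∀ n ≥ N, b n = false}ᶜ =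
      ⋂ N : ℕ, {b : ℕ → Bool | ∃ n ≥ N, b n = true} := by
    ext b; simp
  refine ⟨_, dense_setOf_eventually_eq false, ?_, ?_⟩
  · rw [h]
    exact IsGδ.iInter_of_isOpen fun N => isOpen_setOf_exists_ge_eq N true
  · refine (dense_setOf_eventually_eq true).mono ?_
    rintro b ⟨N, hN⟩ ⟨N', hN'⟩
    have h1 := hN _ (le_max_left N N')
    rw [hN' _ (le_max_right N N')] at h1
    exact Bool.false_ne_true h1

/-- The Cantor space is homeomorphic to its square. -/
def cantorProdHomeomorph : (ℕ → Bool) × (ℕ → Bool) ≃ₜ (ℕ → Bool) :=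
  Homeomorph.sumArrowHomeomorphProdArrow.symm.trans
    (Homeomorph.piCongrLeft (Y := fun _ => Bool) Equiv.natSumNatEquivNat)

/-- The canonical homeomorphism from `(2^ω × S) × 2^ω` onto `2^ω × S`. -/
def cantorAbsorb (S : Type*) [TopologicalSpace S] :
    ((ℕ → Bool) × S) × (ℕ → Bool) ≃ₜ (ℕ → Bool) × S where
  toFun z := (cantorProdHomeomorph (z.1.1, z.2), z.1.2)
  invFun z := (((cantorProdHomeomorph.symm z.1).1, z.2), (cantorProdHomeomorph.symm z.1).2)
  left_inv z := by simp
  right_inv z := by simp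
  continuous_toFun := by fun_prop
  continuous_invFun := by fun_prop

/-- If `E` is continuous, the images of the sections `{w} × S` depend continuously on `w` in the
Vietoris topology. -/
theorem continuous_vietoris_range {W S Y : Type*} [TopologicalSpace W] [TopologicalSpace S]
    [CompactSpace S] [TopologicalSpace Y] {E : W × S → Y} (hE : Continuous E) :
    @Continuous W (Set Y) _ (_root_.vietoris Y) fun w => range fun s => E (w, s) := by
  refine continuous_generateFrom_iff.2 ?_
  rintro _ (⟨U, hU, rfl⟩ | ⟨U, hU, rfl⟩)
  · have : (fun w => range fun s => E (w, s)) ⁻¹' {A | A ⊆ U} =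
        (Prod.fst '' (E ⁻¹' Uᶜ))ᶜ := by
      ext w
      simp [range_subset_iff]
    rw [this]
    exact (isClosedMap_fst_of_compactSpace _ (hU.isClosed_compl.preimage hE)).isOpen_compl
  · have : (fun w => range fun s => E (w, s)) ⁻¹' {A | (A ∩ U).Nonempty} =
        ⋃ s, (fun w => E (w, s)) ⁻¹' U := by
      ext w
      simp [Set.Nonempty]
    rw [this]
    exact isOpen_iUnion fun s => hU.preimage (by fun_prop)

end Construction

/-- There exists an analytic subspace `X` of `2^ω × [0,1]` such that `F₀(X)` is
`Σ¹₂`-complete (as a subset of `F(X)` with an admissible topology). -/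
theorem exists_analytic_subspace_F0_sigma12_complete :
    ∃ X : Set ((ℕ → Bool) × (Set.Icc (0:ℝ) 1)),
      MeasureTheory.AnalyticSet X ∧
      ∀ τ : TopologicalSpace (Cl ↥X), IsAdmissible (↥X) τ →
        @IsSigma12 _ τ (F0 ↥X) ∧ @Sigma12Hard _ τ (F0 ↥X) := by
  have : PolishSpace (Icc (0 : ℝ) 1) := isClosed_Icc.polishSpace
  have : PolishSpace (ℕ → Bool) := {}
  obtain ⟨C, hC, hCd, hCu⟩ := exists_universal_analytic
  obtain ⟨Q, hQ, hQG, hQc⟩ := exists_dense_compl_dense_isGδ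
  let G := cantorAbsorb (Icc (0 : ℝ) 1)
  let M : Set (((ℕ → Bool) × Icc (0 : ℝ) 1) × (ℕ → Bool)) :=
    Prod.snd ⁻¹' Q ∪ Prod.fst ⁻¹' C
  have hMa : MeasureTheory.AnalyticSet M := by
    simp only [M]
    rw [union_eq_iUnion]
    refine MeasureTheory.AnalyticSet.iUnion fun i => ?_
    cases i with
    | false => exact hC.preimage continuous_fst
    | true => exact ((compl_compl Q ▸ hQG.measurableSet.compl).preimage
        measurable_snd).analyticSet
  have hMQ : ∀ k, ∀ q ∈ Q, (k, q) ∈ M := fun k q hq => Or.inl hq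
  have hXa : MeasureTheory.AnalyticSet (G.symm ⁻¹' M) := by
    rw [← G.image_eq_preimage_symm]
    exact hMa.image_of_continuous G.continuous
  refine ⟨G.symm ⁻¹' M, hXa, fun τ hτ => ⟨?_, fun A hA => ?_⟩⟩
  · obtain ⟨q, hq⟩ := hQ.nonempty
    rw [MeasureTheory.AnalyticSet] at hXa
    rcases hXa with h0 | ⟨f, hf, hfr⟩
    · have : G ((0, 0), q) ∈ G.symm ⁻¹' M := by simpa using hMQ (0, 0) q hq
      simp [h0] at this
    · refine isSigma12_F0 (f := fun u => ⟨f u, hfr ▸ mem_range_self u⟩) (by fun_prop) ?_ hτ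
      rintro ⟨z, hz⟩
      obtain ⟨u, rfl⟩ := hfr.symm ▸ hz
      exact ⟨u, rfl⟩
  · obtain ⟨Y, tY, hY, hYm, e, he, rfl⟩ := hτ
    let _ := metrizableSpaceMetric Y
    obtain ⟨w, hw, hwA, hwA'⟩ := hCu A hA
    have hMX : ∀ m : M, G m ∈ G.symm ⁻¹' M := fun m => by simp
    obtain ⟨p, hpQ, E, hE⟩ := exists_section_extension hQ hQG hQc hMQ
      (e := fun m => e ⟨G m, hMX m⟩) (he.continuous.comp (by fun_prop))
    have hMp : ∀ k, (k, p) ∈ M ↔ k ∈ C := fun k => or_iff_right hpQ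
    let ι : G.symm ⁻¹' M → Icc (0 : ℝ) 1 := fun z => (G.symm z).1.2
    let φ : (ℕ → Bool) → Cl (G.symm ⁻¹' M) := fun x =>
      ⟨{z | (G.symm z).2 = p ∧ (G.symm z).1.1 = w x},
        (isClosed_eq (by fun_prop) continuous_const).inter
          (isClosed_eq (by fun_prop) continuous_const)⟩
    have hφ : ∀ x, ∀ z ∈ (φ x).1, (z : (ℕ → Bool) × Icc (0 : ℝ) 1) = G ((w x, ι z), p) := by
      rintro x z ⟨h1, h2⟩
      rw [← h1, ← h2]
      simp [ι]
    have hφC : ∀ x, ∀ z ∈ (φ x).1, (w x, ι z) ∈ C := by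
      intro x z hz
      have h := z.2
      rw [mem_preimage, hφ x z hz, G.symm_apply_apply] at h
      exact (hMp _).1 h
    have hφe : ∀ x s, (w x, s) ∈ C → ∃ z ∈ (φ x).1, ι z = s ∧ e z = E (w x, s) := by
      intro x s hs
      refine ⟨⟨G ((w x, s), p), hMX ⟨_, (hMp _).2 hs⟩⟩, ?_, ?_, (hE _ ((hMp _).2 hs)).symm⟩
      · simp [φ]
      · simp [ι]
    have hcl : ∀ x, closure (e '' (φ x).1) = range fun s => E (w x, s) := by
      intro x
      have hc : Continuous fun s => E (w x, s) := by fun_prop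
      refine subset_antisymm (closure_minimal ?_ (isCompact_range hc).isClosed) ?_
      · rintro _ ⟨z, hz, rfl⟩
        refine ⟨ι z, ?_⟩
        obtain ⟨z', hz', hι, heq⟩ := hφe x _ (hφC x z hz)
        have : z' = z := Subtype.ext (by rw [hφ x z hz, hφ x z' hz', hι])
        rw [← this] at heq ⊢
        exact heq ▸ rfl
      · refine (hc.range_subset_closure_image_dense (hCd (w x))).trans (closure_mono ?_)
        rintro _ ⟨s, hs, rfl⟩
        obtain ⟨z, hz, -, heq⟩ := hφe x s hs
        exact ⟨z, hz, heq⟩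
    refine ⟨φ, continuous_induced_rng.2 ?_, ?_⟩
    · have : (fun F : Cl (G.symm ⁻¹' M) => closure (e '' F.1)) ∘ φ =
          fun x => range fun s => E (w x, s) := funext hcl
      rw [this]
      exact continuous_vietoris_range (E := fun z : (ℕ → Bool) × Icc (0 : ℝ) 1 => E (w z.1, z.2))
        (by fun_prop)
    · ext x
      have hι : IsEmbedding fun z : (φ x).1 => ι z.1 := by
        refine IsEmbedding.of_comp (g := fun s => G ((w x, s), p)) (by fun_prop) (by fun_prop) ?_
        convert IsEmbedding.subtypeVal.comp IsEmbedding.subtypeVal using 1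
        ext1 z
        exact (hφ x z.1 z.2).symm
      by_cases hx : x ∈ A
      · refine iff_of_true hx (dimLE_zero_of_dense_compl_range hι ((hwA x hx).mono ?_))
        rintro s hs ⟨z, rfl⟩
        exact hs (hφC x z.1 z.2)
      · refine iff_of_false hx (not_dimLE_zero_of_surjective hι fun s => ?_)
        obtain ⟨z, hz, hzs, -⟩ := hφe x s (hwA' x hx s)
        exact ⟨⟨z, hz⟩, hzs⟩
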